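/- arXiv:2210.12024 — 2 statements merged into one kernel-verified Lean document; each statement's English description precedes it below -/
import Mathlib

section
/- Let k be an algebraically closed field and let R be a finitely generated commutative k-algebra that is an integral domain of Krull dimension one (equivalently, of Gelfand–Kirillov dimension one). Then every k-algebra automorphism σ of R preserves a frame; that is, there exists a finite-dimensional k-subspace V of R with 1 ∈ V such that V generates R as a k-algebra and σ(V) = V. -/
/-- A frame of a `k`-algebra `R` is a finite-dimensional `k`-subspace `V` of `R`
such that `1 ∈ V` and `V` generates `R` as a `k`-algebra. -/
def IsFrame (k : Type*) {R : Type*} [Field k] [Ring R] [Algebra k R]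
    (V : Submodule k R) : Prop :=
  (1 : R) ∈ V ∧ FiniteDimensional k V ∧ Algebra.adjoin k (V : Set R) = ⊤

open Polynomial

theorem Ring.KrullDimLE.of_isIntegral (A B : Type*) [CommRing A] [IsDomain A] [CommRing B]
    [IsDomain B] [Algebra A B] [Algebra.IsIntegral A B] [FaithfulSMul A B]
    [Ring.KrullDimLE 1 B] : Ring.KrullDimLE 1 A := by
  rw [Ring.krullDimLE_one_iff_of_noZeroDivisors]
  intro P hP0 hP
  have hbot : (⊥ : Ideal B).comap (algebraMap A B) ≤ P := by
    rw [← RingHom.ker_eq_comap_bot,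
      (RingHom.injective_iff_ker_eq_bot _).mp (FaithfulSMul.algebraMap_injective A B)]
    exact bot_le
  obtain ⟨Q, -, hQ, rfl⟩ := Ideal.exists_ideal_over_prime_of_isIntegral P (⊥ : Ideal B) hbot
  have hQ0 : Q ≠ ⊥ := by
    rintro rfl
    apply hP0
    rw [← RingHom.ker_eq_comap_bot]
    exact (RingHom.injective_iff_ker_eq_bot _).mp (FaithfulSMul.algebraMap_injective A B)
  have := hQ.isMaximal_of_ne_bot hQ0
  exact Ideal.isMaximal_comap_of_isIntegral_of_isMaximal Q

/-- Noether normalization in Krull dimension one: the algebra is a finite extension of a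
polynomial ring in one variable. -/
theorem exists_finite_polynomial_algebra_of_ringKrullDim_eq_one (k R : Type*) [Field k]
    [CommRing R] [IsDomain R] [Algebra k R] [Algebra.FiniteType k R]
    (hdim : ringKrullDim R = 1) :
    ∃ _ : Algebra k[X] R, IsScalarTower k k[X] R ∧ Module.Finite k[X] R ∧
      FaithfulSMul k[X] R := by
  obtain ⟨s, g, hg, hfin⟩ := exists_finite_inj_algHom_of_fg k R
  have hs : s = 1 := by
    algebraize [g.toRingHom]
    have : FaithfulSMul (MvPolynomial (Fin s) k) R :=
      (faithfulSMul_iff_algebraMap_injective _ _).2 hg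
    have : Module.Finite (MvPolynomial (Fin s) k) R := hfin
    have : Ring.KrullDimLE 1 R := by rw [Ring.krullDimLE_iff, hdim]; rfl
    have hA := Ring.KrullDimLE.of_isIntegral (MvPolynomial (Fin s) k) R
    rw [Ring.krullDimLE_iff, MvPolynomial.ringKrullDim_of_isNoetherianRing,
      ringKrullDim_eq_zero_of_field] at hA
    have hs1 : s ≤ 1 := by
      simpa using hA
    have hs0 : s ≠ 0 := by
      rintro rfl
      have hR : IsField R := isField_of_isIntegral_of_isField'
        ((MvPolynomial.isEmptyRingEquiv k (Fin 0)).toMulEquiv.isField (Field.toIsField k))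
      rw [ringKrullDim_eq_zero_of_isField hR] at hdim
      exact zero_ne_one hdim
    omega
  subst hs
  let φ : k[X] →ₐ[k] R := g.comp (MvPolynomial.uniqueAlgEquiv k (Fin 1)).symm.toAlgHom
  let _ : Algebra k[X] R := φ.toRingHom.toAlgebra
  refine ⟨φ.toRingHom.toAlgebra, IsScalarTower.of_algHom φ, ?_, ?_⟩
  · have : φ.toRingHom.Finite := RingHom.Finite.comp (g := g.toRingHom) hfin
      (RingHom.Finite.of_surjective _ (MvPolynomial.uniqueAlgEquiv k (Fin 1)).symm.surjective)
    exact this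
  · exact (faithfulSMul_iff_algebraMap_injective _ _).2
      (hg.comp (MvPolynomial.uniqueAlgEquiv k (Fin 1)).symm.injective)

theorem isAlgebraic_adjoin_singleton_of_transcendental {k R : Type*} [Field k]
    [CommRing R] [IsDomain R] [Algebra k R] [Algebra k[X] R] [IsScalarTower k k[X] R]
    [Algebra.IsAlgebraic k[X] R] [FaithfulSMul k[X] R] {f : R} (hf : Transcendental k f) :
    Algebra.IsAlgebraic (Algebra.adjoin k {f}) R := by
  have h1 : Algebra.trdeg k R = 1 := by
    have := lift_trdeg_add_eq k k[X] R
    simpa [trdeg_eq_zero] using this.symm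
  have hi : AlgebraicIndependent k (fun _ : Unit ↦ f) :=
    algebraicIndependent_unique_type_iff.2 hf
  have := (hi.isTranscendenceBasis_of_lift_trdeg_le_of_finite (by simp [h1])).isAlgebraic
  rwa [Set.range_const] at this

/-- `f` has degree at most `m` if every element `x` satisfies a nontrivial algebraic relation
with `f` of degree at most `m` in `x`. -/
def HasCodegreeLE (k : Type*) {R : Type*} [Field k] [CommRing R] [Algebra k R] (m : ℕ) (f : R) :
    Prop :=
  ∀ x : R, ∃ F : k[X][X], F ≠ 0 ∧ F.natDegree ≤ m ∧ aevalAeval f x F = 0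

theorem exists_hasCodegreeLE (k : Type*) {R : Type*} [Field k]
    [CommRing R] [IsDomain R] [Algebra k R] [Algebra.FiniteType k R]
    [Algebra k[X] R] [IsScalarTower k k[X] R]
    [Algebra.IsAlgebraic k[X] R] [FaithfulSMul k[X] R] (f : R) :
    ∃ m, HasCodegreeLE k m f := by
  by_cases hf : IsAlgebraic k f
  · obtain ⟨p, hp0, hp⟩ := hf
    exact ⟨0, fun x ↦ ⟨C p, by simpa using hp0, by simp, by simpa using hp⟩⟩
  have := isAlgebraic_adjoin_singleton_of_transcendental hf
  let A := Algebra.adjoin k {f}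
  let L := FractionRing R
  let E := FractionRing A
  let _ : Algebra E L := FractionRing.liftAlgebra A L
  have : Algebra.IsAlgebraic A L := (IsFractionRing.isAlgebraic_iff' A R L).1 this
  have : Algebra.IsAlgebraic E L := IsFractionRing.comap_isAlgebraic_iff.1 this
  have : Algebra.EssFiniteType k L := Algebra.EssFiniteType.comp k R L
  have : Algebra.EssFiniteType E L := Algebra.EssFiniteType.of_comp k E L
  have : Module.Finite E L := Algebra.finite_of_essFiniteType_of_isAlgebraic
  refine ⟨Module.finrank E L, fun x ↦ ?_⟩
  have hdep : ¬ LinearIndependent A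
      (fun i : Fin (Module.finrank E L + 1) ↦ (algebraMap R L x) ^ (i : ℕ)) := by
    rw [LinearIndependent.iff_fractionRing A E]
    intro h
    simpa using h.fintype_card_le_finrank
  rw [Fintype.not_linearIndependent_iff] at hdep
  obtain ⟨c, hc, i, hi⟩ := hdep
  have hlift (i) : ∃ p : k[X], aeval f p = c i := by
    have : (c i : R) ∈ Algebra.adjoin k {f} := (c i).2
    rwa [Algebra.adjoin_singleton_eq_range_aeval] at this
  choose p hp using hlift
  refine ⟨∑ i : Fin _, monomial (i : ℕ) (p i), ?_, ?_, ?_⟩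
  · intro h
    apply hi
    have := congr_arg (fun F ↦ coeff F i) h
    simp [coeff_monomial, Fin.val_inj] at this
    ext
    rw [← hp, this, map_zero]; rfl
  · refine natDegree_sum_le_of_forall_le _ _ fun i _ ↦ (natDegree_monomial_le _).trans ?_
    exact Nat.lt_succ_iff.1 i.2
  · apply IsFractionRing.injective R L
    rw [map_zero, ← hc, map_sum, map_sum]
    refine Finset.sum_congr rfl fun i _ ↦ ?_
    rw [← C_mul_X_pow_eq_monomial, map_mul, map_pow, aevalAeval_C, aevalAeval_Y, hp, map_mul,
      map_pow, Algebra.smul_def]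
    rfl

theorem Polynomial.Bivariate.coeff_coeff_swap {k : Type*} [CommSemiring k] (F : k[X][X])
    (i j : ℕ) : ((swap F).coeff i).coeff j = (F.coeff j).coeff i := by
  induction F using Polynomial.induction_on' with
  | add p q hp hq => simp only [map_add, coeff_add, hp, hq]
  | monomial n a =>
    induction a using Polynomial.induction_on' with
    | add p q hp hq => simp only [map_add, coeff_add, hp, hq]
    | monomial m r =>
      rw [swap_monomial_monomial]
      simp only [coeff_monomial]
      split_ifs <;> simp_all [coeff_monomial]

theorem Polynomial.Bivariate.natDegree_coeff_le_natDegree_swap {k : Type*} [CommSemiring k]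
    (F : k[X][X]) (i : ℕ) : (F.coeff i).natDegree ≤ (swap F).natDegree := by
  rw [natDegree_le_iff_coeff_eq_zero]
  intro j hj
  rw [← coeff_coeff_swap, coeff_eq_zero_of_natDegree_lt hj, coeff_zero]

theorem Polynomial.aevalAeval_eq_eval₂ {k A : Type*} [CommSemiring k] [CommSemiring A] [Algebra k A]
    (x y : A) (F : k[X][X]) : aevalAeval x y F = F.eval₂ (aeval x : k[X] →ₐ[k] A).toRingHom y := by
  induction F using Polynomial.induction_on' with
  | add p q hp hq => simp only [map_add, eval₂_add, hp, hq]
  | monomial n a =>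
    rw [eval₂_monomial, ← C_mul_X_pow_eq_monomial, map_mul, map_pow, aevalAeval_C, aevalAeval_Y]
    rfl

theorem Polynomial.aeval_eq_aevalAeval {k A : Type*} [CommSemiring k] [CommSemiring A]
    [Algebra k A] [Algebra k[X] A] [IsScalarTower k k[X] A] (a : A) (F : k[X][X]) :
    aeval a F = aevalAeval (algebraMap k[X] A X) a F := by
  rw [aevalAeval_eq_eval₂, aeval_def]
  congr 1
  ext p
  · simpa using (IsScalarTower.algebraMap_apply k k[X] A p).symm
  · simp

theorem HasCodegreeLE.natDegree_coeff_minpoly_le {k R : Type*} [Field k] [CommRing R] [IsDomain R]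
    [Algebra k R] [Algebra k[X] R] [IsScalarTower k k[X] R] [Algebra.IsIntegral k[X] R]
    [FaithfulSMul k[X] R] {m : ℕ} {f : R} (h : HasCodegreeLE k m f) (i : ℕ) :
    ((minpoly k[X] f).coeff i).natDegree ≤ m := by
  obtain ⟨F, hF0, hFm, hF⟩ := h (algebraMap k[X] R X)
  have hG : aeval f (Bivariate.swap F) = 0 := by
    rw [aeval_eq_aevalAeval, Bivariate.aevalAeval_swap, hF]
  obtain ⟨q, hq⟩ := minpoly.isIntegrallyClosed_dvd (Algebra.IsIntegral.isIntegral f) hG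
  have hF' : F = Bivariate.swap (minpoly k[X] f) * Bivariate.swap q := by
    rw [← map_mul, ← hq, Bivariate.swap_swap_apply]
  refine (Bivariate.natDegree_coeff_le_natDegree_swap _ i).trans (le_trans ?_ hFm)
  exact natDegree_le_of_dvd ⟨_, hF'⟩ hF0

theorem Polynomial.aeval_mul_inv_pow_mem_adjoin {k K : Type*} [Field k] [Field K] [Algebra k K]
    {ξ : K} (hξ : ξ ≠ 0) {g : k[X]} {N : ℕ} (hg : g.natDegree ≤ N) :
    aeval ξ g * ξ⁻¹ ^ N ∈ Algebra.adjoin k {ξ⁻¹} := by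
  rw [aeval_eq_sum_range' (Nat.lt_succ_of_le hg), Finset.sum_mul]
  refine Subalgebra.sum_mem _ fun i hi ↦ ?_
  have hi : i ≤ N := Nat.lt_succ_iff.1 (Finset.mem_range.1 hi)
  have : g.coeff i • ξ ^ i * ξ⁻¹ ^ N = g.coeff i • ξ⁻¹ ^ (N - i) := by
    rw [smul_mul_assoc, ← Nat.sub_add_cancel hi, pow_add, mul_comm (ξ⁻¹ ^ (N - i)), ← mul_assoc,
      ← mul_pow, mul_inv_cancel₀ hξ, one_pow, one_mul, Nat.add_sub_cancel]
  rw [this]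
  exact Subalgebra.smul_mem _ (pow_mem (Algebra.self_mem_adjoin_singleton _ _) _) _

/-- The elements of `R` with poles of order at most `m` relative to `ξ : K`, as detected by
integrality over `k[ξ⁻¹]`. -/
def poleOrderLE (k R : Type*) {K : Type*} [Field k] [CommRing R] [Algebra k R] [Field K]
    [Algebra k K] [Algebra R K] [IsScalarTower k R K] (ξ : K) (m : ℕ) : Submodule k R where
  carrier := {f | IsIntegral (Algebra.adjoin k {ξ⁻¹}) (algebraMap R K f * ξ⁻¹ ^ m)}
  zero_mem' := by simpa using isIntegral_zero
  add_mem' {a b} ha hb := by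
    simpa only [Set.mem_ofPred_eq, map_add, add_mul] using ha.add hb
  smul_mem' c a ha := by
    simpa only [Set.mem_ofPred_eq, algebraMap.smul, smul_mul_assoc] using
      IsIntegral.smul c ha

section

variable {k R K : Type*} [Field k] [CommRing R] [Algebra k R] [Field K]
    [Algebra k K] [Algebra R K] [IsScalarTower k R K]

theorem mem_poleOrderLE {ξ : K} {m : ℕ} {f : R} : f ∈ poleOrderLE k R ξ m ↔
    IsIntegral (Algebra.adjoin k {ξ⁻¹}) (algebraMap R K f * ξ⁻¹ ^ m) := Iff.rfl

variable [IsDomain R] [Algebra k[X] R] [IsScalarTower k k[X] R] [Algebra.IsIntegral k[X] R]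
    [FaithfulSMul k[X] R] [FaithfulSMul R K]

theorem HasCodegreeLE.mem_poleOrderLE {m : ℕ} {f : R} (h : HasCodegreeLE k m f) :
    f ∈ poleOrderLE k R (algebraMap R K (algebraMap k[X] R X)) m := by
  set ξ := algebraMap R K (algebraMap k[X] R X) with hξ
  have hξ0 : ξ ≠ 0 := by simp [hξ]
  let T := Algebra.adjoin k {ξ⁻¹}
  let φ : k[X] →+* K := (algebraMap R K).comp (algebraMap k[X] R)
  have hφ (p : k[X]) : φ p = aeval ξ p := by
    rw [hξ, aeval_algebraMap_apply, aeval_algebraMap_apply, aeval_X_left_apply]; rfl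
  let p := (minpoly k[X] f).map φ
  have hp : p.Monic := (minpoly.monic (Algebra.IsIntegral.isIntegral f)).map φ
  let q := p.scaleRoots (ξ⁻¹ ^ m)
  have hq : q.Monic := (monic_scaleRoots_iff _).2 hp
  have hroot : q.eval (algebraMap R K f * ξ⁻¹ ^ m) = 0 := by
    rw [mul_comm]
    have : p.eval (algebraMap R K f) = 0 := by
      rw [eval_map, ← hom_eval₂, ← aeval_def, minpoly.aeval, map_zero]
    simpa [this, q, eval₂_id] using
      scaleRoots_eval₂_mul (RingHom.id K) (algebraMap R K f) (ξ⁻¹ ^ m) (p := p)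
  have hlift : q ∈ lifts (algebraMap T K) := by
    rw [lifts_iff_coeff_lifts]
    intro i
    suffices q.coeff i ∈ T from ⟨⟨_, this⟩, rfl⟩
    rw [coeff_scaleRoots]
    rcases lt_trichotomy i p.natDegree with hi | rfl | hi
    · rw [coeff_map, hφ, ← pow_mul]
      refine aeval_mul_inv_pow_mem_adjoin hξ0 ((h.natDegree_coeff_minpoly_le i).trans ?_)
      exact Nat.le_mul_of_pos_right _ (Nat.sub_pos_of_lt hi)
    · rw [Nat.sub_self, pow_zero, mul_one, hp.coeff_natDegree]
      exact one_mem _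
    · rw [coeff_eq_zero_of_natDegree_lt hi, zero_mul]
      exact zero_mem _
  obtain ⟨Q, hQ, -, hQm⟩ := lifts_and_natDegree_eq_and_monic hlift hq
  refine ⟨Q, hQm, ?_⟩
  rw [← eval_map, hQ, hroot]

theorem isAlgebraic_of_mem_poleOrderLE_zero {f : R}
    (hf : f ∈ poleOrderLE k R (algebraMap R K (algebraMap k[X] R X)) 0) : IsAlgebraic k f := by
  set ξ := algebraMap R K (algebraMap k[X] R X) with hξ
  have hξ0 : ξ ≠ 0 := by simp [hξ]
  have : Invertible ξ⁻¹ := invertibleOfNonzero (inv_ne_zero hξ0)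
  obtain ⟨Q₀, hQ₀, hroot₀⟩ := hf
  rw [pow_zero, mul_one] at hroot₀
  have hlift : Q₀.map (algebraMap _ K) ∈ lifts (aeval ξ⁻¹ : k[X] →ₐ[k] K).toRingHom := by
    rw [lifts_iff_coeff_lifts]
    intro i
    obtain ⟨p, hp⟩ := (Algebra.adjoin_singleton_eq_range_aeval k ξ⁻¹).le (Q₀.coeff i).2
    exact ⟨p, by rw [coeff_map]; exact hp⟩
  obtain ⟨Q, hQ, -, hQm⟩ := lifts_and_natDegree_eq_and_monic hlift (hQ₀.map _)
  have hroot : aevalAeval ξ⁻¹ (algebraMap R K f) Q = 0 := by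
    rw [aevalAeval_eq_eval₂, ← eval_map, hQ, eval_map, hroot₀]
  let N := (Bivariate.swap Q).natDegree
  let G := reflect N (Bivariate.swap Q)
  let F := Bivariate.swap G
  have hFcoeff (i j : ℕ) : (F.coeff i).coeff j = (Q.coeff i).coeff (revAt N j) := by
    rw [Bivariate.coeff_coeff_swap, coeff_reflect, Bivariate.coeff_coeff_swap]
  have hF : aeval f F = 0 := by
    apply FaithfulSMul.algebraMap_injective R K
    have h1 := eval₂_reflect_mul_pow (aeval (algebraMap R K f) : k[X] →ₐ[k] K).toRingHom ξ⁻¹ N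
      (Bivariate.swap Q) le_rfl
    rw [← aevalAeval_eq_eval₂, ← aevalAeval_eq_eval₂, Bivariate.aevalAeval_swap, hroot,
      invOf_eq_inv, inv_inv] at h1
    have h2 := (mul_eq_zero.1 h1).resolve_right (pow_ne_zero _ (inv_ne_zero hξ0))
    have h3 : aevalAeval ξ (algebraMap R K f) F = 0 := by
      rw [Bivariate.aevalAeval_swap]; exact h2
    rw [map_zero, aeval_eq_aevalAeval, ← h3, aevalAeval_eq_eval₂, aevalAeval_eq_eval₂, hom_eval₂]
    congr 1
    ext p <;> simp [hξ, ← IsScalarTower.algebraMap_apply]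
  have hFtop : F.coeff Q.natDegree = X ^ N := by
    ext j
    rw [hFcoeff, hQm.coeff_natDegree, coeff_one, coeff_X_pow]
    by_cases hj : j ≤ N
    · rw [revAt_le hj]
      congr 1
      simp only [eq_iff_iff]
      omega
    · rw [revAt_eq_self_of_lt (not_le.1 hj), if_neg (by omega), if_neg (by omega)]
  have hFdeg : F.natDegree ≤ Q.natDegree := by
    rw [natDegree_le_iff_coeff_eq_zero]
    intro i hi
    ext j
    rw [hFcoeff, coeff_eq_zero_of_natDegree_lt hi, coeff_zero, coeff_zero]
  have hFlead : F.leadingCoeff = X ^ N := by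
    rw [← hFtop, leadingCoeff, hFdeg.antisymm (le_natDegree_of_ne_zero _)]
    rw [hFtop]
    exact pow_ne_zero _ X_ne_zero
  have hint : IsIntegral k[X] f := Algebra.IsIntegral.isIntegral f
  obtain ⟨q, hq⟩ := minpoly.isIntegrallyClosed_dvd hint hF
  have hq0 : q ≠ 0 := by
    rintro rfl
    rw [hq, mul_zero, leadingCoeff_zero] at hFlead
    exact pow_ne_zero _ X_ne_zero hFlead.symm
  have hqlead : q.leadingCoeff = X ^ N := by
    rw [← hFlead, hq, leadingCoeff_mul, minpoly.monic hint, one_mul]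
  have hqN : N ≤ (Bivariate.swap q).natDegree := by
    have := Bivariate.natDegree_coeff_le_natDegree_swap q q.natDegree
    rwa [coeff_natDegree, hqlead, natDegree_X_pow] at this
  have hsum : (Bivariate.swap (minpoly k[X] f)).natDegree + (Bivariate.swap q).natDegree ≤ N := by
    rw [← natDegree_mul (by simpa using minpoly.ne_zero hint) (by simpa using hq0), ← map_mul,
      ← hq, Bivariate.swap_swap_apply]
    exact natDegree_reflect_le.trans (max_le le_rfl le_rfl)
  have hdeg : (Bivariate.swap (minpoly k[X] f)).natDegree = 0 := by omega
  obtain ⟨p, hp⟩ := natDegree_eq_zero.1 hdeg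
  refine ⟨p, ?_, ?_⟩
  · rintro rfl
    rw [C_0] at hp
    exact minpoly.ne_zero hint (by simpa using hp.symm)
  · have := minpoly.aeval k[X] f
    rwa [aeval_eq_aevalAeval, ← Bivariate.aevalAeval_swap, ← hp, aevalAeval_C] at this

end

theorem exists_sum_smul_mem_poleOrderLE {k R K : Type*} [Field k] [CommRing R] [Algebra k R]
    [Field K] [Algebra k K] [Algebra R K] [IsScalarTower k R K] [Algebra k[X] R]
    [IsScalarTower k k[X] R] [FaithfulSMul k[X] R] [FaithfulSMul R K] [Module.Finite k[X] R]
    (m : ℕ)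
    (v : Fin (Module.finrank k[X] R + 1) → R)
    (hv : ∀ i, v i ∈ poleOrderLE k R (algebraMap R K (algebraMap k[X] R X)) (m + 1)) :
    ∃ c : Fin (Module.finrank k[X] R + 1) → k, c ≠ 0 ∧
      ∑ i, c i • v i ∈ poleOrderLE k R (algebraMap R K (algebraMap k[X] R X)) m := by
  set ξ := algebraMap R K (algebraMap k[X] R X) with hξ
  have hξ0 : ξ ≠ 0 := by simp [hξ]
  have hdep : ¬ LinearIndependent k[X] v := fun h ↦ by
    simpa using h.fintype_card_le_finrank
  rw [Fintype.not_linearIndependent_iff] at hdep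
  obtain ⟨g, hg, i₀, hi₀⟩ := hdep
  obtain ⟨i₁, -, hi₁⟩ := Finset.exists_max_image Finset.univ (fun i ↦ (g i).degree) ⟨i₀, by simp⟩
  have hgi₁ : g i₁ ≠ 0 := fun h ↦ hi₀ <| by simpa [h] using hi₁ i₀ (Finset.mem_univ _)
  let N := (g i₁).natDegree
  let h (i) : k[X] := g i - C ((g i).coeff N) * X ^ N
  have hh (i) (hi : h i ≠ 0) : (h i).natDegree + 1 ≤ N := by
    refine Nat.succ_le_of_lt ((natDegree_lt_iff_degree_lt hi).2 ?_)
    rw [degree_lt_iff_coeff_zero]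
    intro j hj
    rcases hj.eq_or_lt with rfl | hj
    · simp [h]
    · have : (g i).natDegree ≤ N := natDegree_le_natDegree (hi₁ i (Finset.mem_univ _))
      simp [h, coeff_X_pow, hj.ne', coeff_eq_zero_of_natDegree_lt (this.trans_lt hj)]
  have hint (i) : IsIntegral (Algebra.adjoin k {ξ⁻¹})
      (aeval ξ (h i) * ξ⁻¹ ^ N * (algebraMap R K (v i) * ξ⁻¹ ^ m)) := by
    by_cases hi : h i = 0
    · simpa [hi] using isIntegral_zero
    obtain ⟨M, hM⟩ : ∃ M, N = M + 1 := ⟨N - 1, by have := hh i hi; omega⟩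
    have hT := aeval_mul_inv_pow_mem_adjoin (k := k) hξ0 (g := h i) (N := M)
      (by have := hh i hi; omega)
    have := (isIntegral_algebraMap (R := Algebra.adjoin k {ξ⁻¹}) (A := K) (x := ⟨_, hT⟩)).mul
      (mem_poleOrderLE.1 (hv i))
    have e : aeval ξ (h i) * ξ⁻¹ ^ N * (algebraMap R K (v i) * ξ⁻¹ ^ m) =
        aeval ξ (h i) * ξ⁻¹ ^ M * (algebraMap R K (v i) * ξ⁻¹ ^ (m + 1)) := by
      rw [hM]; ring
    rw [e]
    exact this
  refine ⟨fun i ↦ (g i).coeff N, fun h0 ↦ hgi₁ ?_, ?_⟩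
  · exact leadingCoeff_eq_zero.1 (congr_fun h0 i₁)
  rw [mem_poleOrderLE]
  have hrel : ∑ i, aeval ξ (g i) * algebraMap R K (v i) = 0 := by
    rw [← map_zero (algebraMap R K), ← hg, map_sum]
    refine Finset.sum_congr rfl fun i _ ↦ ?_
    rw [Algebra.smul_def, map_mul, hξ, aeval_algebraMap_apply, aeval_algebraMap_apply,
      aeval_X_left_apply]
  have hterm (i) : aeval ξ (h i) * ξ⁻¹ ^ N * (algebraMap R K (v i) * ξ⁻¹ ^ m) =
      aeval ξ (g i) * algebraMap R K (v i) * (ξ⁻¹ ^ N * ξ⁻¹ ^ m) -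
        algebraMap R K ((g i).coeff N • v i) * ξ⁻¹ ^ m := by
    have hN : ξ ^ N * ξ⁻¹ ^ N = 1 := by rw [← mul_pow, mul_inv_cancel₀ hξ0, one_pow]
    simp only [h, map_sub, map_mul, map_pow, aeval_C, aeval_X, Algebra.smul_def,
      ← IsScalarTower.algebraMap_apply]
    linear_combination (-algebraMap k K ((g i).coeff N) * algebraMap R K (v i) * ξ⁻¹ ^ m) * hN
  have hsum : algebraMap R K (∑ i, (g i).coeff N • v i) * ξ⁻¹ ^ m =
      -∑ i, aeval ξ (h i) * ξ⁻¹ ^ N * (algebraMap R K (v i) * ξ⁻¹ ^ m) := by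
    simp only [hterm, Finset.sum_sub_distrib, ← Finset.sum_mul, hrel, map_sum]
    ring
  rw [hsum]
  exact (IsIntegral.sum (s := Finset.univ) _ fun i _ ↦ hint i).neg

theorem Submodule.finite_of_exists_sum_smul_mem {k M : Type*} [Field k] [AddCommGroup M]
    [Module k M] (U W : Submodule k M) [Module.Finite k W] (d : ℕ)
    (h : ∀ v : Fin d → M, (∀ i, v i ∈ U) → ∃ c : Fin d → k, c ≠ 0 ∧ ∑ i, c i • v i ∈ W) :
    Module.Finite k U := by
  let f : U →ₗ[k] M ⧸ W := W.mkQ.comp U.subtype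
  have hrank : Module.rank k (LinearMap.range f) < d := by
    by_contra! hle
    obtain ⟨w, hw⟩ := exists_linearIndependent_of_le_rank hle
    choose u hu using fun i ↦ (w i).2
    obtain ⟨c, hc0, hc⟩ := h (fun i ↦ u i) fun i ↦ (u i).2
    apply hc0
    ext i
    refine Fintype.linearIndependent_iff.1 hw c ?_ i
    ext
    rw [Submodule.coe_sum]
    simp_rw [Submodule.coe_smul, ← hu]
    rw [← Submodule.Quotient.mk_eq_zero W, ← Submodule.mkQ_apply, map_sum] at hc
    simp_rw [map_smul] at hc
    exact hc
  have : Module.Finite k (LinearMap.range f) :=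
    Module.rank_lt_aleph0_iff.1 (hrank.trans (Cardinal.natCast_lt_aleph0))
  have hker : Module.Finite k (LinearMap.ker f) := by
    have hle (x : LinearMap.ker f) : ((x : U) : M) ∈ W :=
      (Submodule.Quotient.mk_eq_zero W).1 (LinearMap.mem_ker.1 x.2)
    let g : LinearMap.ker f →ₗ[k] W :=
      (U.subtype.comp (LinearMap.ker f).subtype).codRestrict W hle
    refine Module.Finite.of_injective g fun x y hxy ↦ ?_
    exact Subtype.ext (Subtype.ext (congr_arg (fun z : W ↦ (z : M)) hxy))
  have : Module.Finite k (U ⧸ LinearMap.ker f) :=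
    Module.Finite.equiv f.quotKerEquivRange.symm
  exact Module.Finite.of_submodule_quotient (LinearMap.ker f)

theorem IsAlgClosed.mem_one_of_isAlgebraic {k R : Type*} [Field k] [IsAlgClosed k] [CommRing R]
    [IsDomain R] [Algebra k R] {f : R} (hf : IsAlgebraic k f) : f ∈ (1 : Submodule k R) := by
  let S := Algebra.adjoin k {f}
  have : Algebra.IsIntegral k S := Algebra.IsIntegral.adjoin (by simpa using hf.isIntegral)
  obtain ⟨c, hc⟩ := (IsAlgClosed.algebraMap_bijective_of_isIntegral (k := k) (K := S)).2
    ⟨f, Algebra.self_mem_adjoin_singleton k f⟩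
  exact Submodule.mem_one.2 ⟨c, congr_arg (fun s : S ↦ (s : R)) hc⟩

theorem finite_poleOrderLE {k R : Type*} (K : Type*) [Field k] [IsAlgClosed k] [CommRing R]
    [IsDomain R] [Algebra k R] [Field K] [Algebra k K] [Algebra R K] [IsScalarTower k R K]
    [FaithfulSMul R K] [Algebra k[X] R] [IsScalarTower k k[X] R] [Module.Finite k[X] R]
    [FaithfulSMul k[X] R] (m : ℕ) :
    Module.Finite k (poleOrderLE k R (algebraMap R K (algebraMap k[X] R X)) m) := by
  induction m with
  | zero =>
    have : Module.Finite k (1 : Submodule k R) := by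
      rw [Submodule.one_eq_span]; infer_instance
    exact Submodule.finiteDimensional_of_le fun f hf ↦
      IsAlgClosed.mem_one_of_isAlgebraic (isAlgebraic_of_mem_poleOrderLE_zero hf)
  | succ m ih =>
    exact Submodule.finite_of_exists_sum_smul_mem _ _ _ (exists_sum_smul_mem_poleOrderLE m)

theorem HasCodegreeLE.mono {k R : Type*} [Field k] [CommRing R] [Algebra k R] {m n : ℕ}
    (hmn : m ≤ n) {f : R} (h : HasCodegreeLE k m f) : HasCodegreeLE k n f := fun x ↦
  let ⟨F, hF0, hFm, hF⟩ := h x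
  ⟨F, hF0, hFm.trans hmn, hF⟩

theorem HasCodegreeLE.map_algEquiv {k R : Type*} [Field k] [CommRing R] [Algebra k R] {m : ℕ}
    {f : R} (h : HasCodegreeLE k m f) (σ : R ≃ₐ[k] R) : HasCodegreeLE k m (σ f) := fun x ↦ by
  obtain ⟨F, hF0, hFm, hF⟩ := h (σ.symm x)
  refine ⟨F, hF0, hFm, ?_⟩
  have : aevalAeval (σ f) x = σ.toAlgHom.comp (aevalAeval f (σ.symm x)) := by
    ext <;> simp
  rw [this, AlgHom.comp_apply, hF, map_zero]

theorem hasCodegreeLE_one {k R : Type*} [Field k] [CommRing R] [Algebra k R] (m : ℕ) :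
    HasCodegreeLE k m (1 : R) := fun _ ↦
  ⟨C (X - C 1), C_ne_zero.2 (X_sub_C_ne_zero 1), (natDegree_C _).trans_le (Nat.zero_le _),
    by rw [aevalAeval_C]; simp⟩

/-- Let `k` be an algebraically closed field and `R` a finitely generated commutative
`k`-algebra that is an integral domain of Krull dimension one.  Then every `k`-algebra
automorphism `σ` of `R` preserves a frame. -/
theorem automorphism_preserves_frame_of_dim_one
    (k R : Type*) [Field k] [IsAlgClosed k] [CommRing R] [IsDomain R]
    [Algebra k R] [Algebra.FiniteType k R]
    (hdim : ringKrullDim R = 1)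
    (σ : R ≃ₐ[k] R) :
    ∃ V : Submodule k R, IsFrame k V ∧ V.map σ.toLinearMap = V := by
  obtain ⟨_, _, _, _⟩ := exists_finite_polynomial_algebra_of_ringKrullDim_eq_one k R hdim
  obtain ⟨s, hs⟩ := Algebra.FiniteType.out (R := k) (A := R)
  choose deg hdeg using exists_hasCodegreeLE k (R := R)
  let m := s.sup deg
  let S : Set R := {f | HasCodegreeLE k m f}
  refine ⟨Submodule.span k S, ⟨Submodule.subset_span (hasCodegreeLE_one m), ?_, ?_⟩, ?_⟩
  · have := finite_poleOrderLE (k := k) (R := R) (FractionRing R) m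
    have hle : Submodule.span k S ≤
        poleOrderLE k R (algebraMap R (FractionRing R) (algebraMap k[X] R X)) m :=
      Submodule.span_le.2 fun f hf ↦ HasCodegreeLE.mem_poleOrderLE hf
    exact Submodule.finiteDimensional_of_le hle
  · rw [eq_top_iff, ← hs]
    exact Algebra.adjoin_mono fun f hf ↦
      Submodule.subset_span ((hdeg f).mono (Finset.le_sup (f := deg) hf))
  · rw [Submodule.map_span]
    congr 1
    ext f
    constructor
    · rintro ⟨g, hg, rfl⟩
      exact HasCodegreeLE.map_algEquiv hg σ
    · exact fun hf ↦ ⟨σ.symm f, HasCodegreeLE.map_algEquiv hf σ.symm, by simp⟩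
end

section
/- Let k be an algebraically closed field and let R be a finitely generated reduced commutative k-algebra of Krull dimension at most one (equivalently, of Gelfand–Kirillov dimension at most one). Then every k-algebra automorphism σ of R preserves a frame; that is, there exists a finite-dimensional k-subspace V of R with 1 ∈ V such that V generates R as a k-algebra and σ(V) = V. -/
section

open Polynomial

theorem Polynomial.Bivariate.coeff_coeff_swap_s1 {R : Type*} [CommSemiring R] (p : R[X][X])
    (i j : ℕ) : ((Bivariate.swap p).coeff i).coeff j = (p.coeff j).coeff i := by
  induction p using Polynomial.induction_on' with
  | add p q hp hq => simp [hp, hq]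
  | monomial n a =>
    induction a using Polynomial.induction_on' with
    | add p q hp hq => simp only [map_add, coeff_add, hp, hq]
    | monomial m r =>
      rw [Bivariate.swap_monomial_monomial]
      simp only [coeff_monomial]
      split_ifs <;> simp_all [coeff_monomial]

theorem Polynomial.aevalAeval_algebraMap_X {k A : Type*} [CommRing k] [CommRing A] [Algebra k A]
    [Algebra k[X] A] [IsScalarTower k k[X] A] (g : A) (p : k[X][X]) :
    aevalAeval (algebraMap k[X] A X) g p = aeval g p := by
  induction p using Polynomial.induction_on' with
  | add p q hp hq => simp only [map_add, hp, hq]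
  | monomial n a =>
    rw [aeval_monomial, ← C_mul_X_pow_eq_monomial, map_mul, map_pow, aevalAeval_C, aevalAeval_Y,
      aeval_algebraMap_apply, aeval_X_left_apply]

section Pole

variable (k : Type*) [Field k]

open Classical in
/-- The ring of rational functions over `k` which are regular at infinity. -/
noncomputable def regularAtInfty : Subring (RatFunc k) := (RatFunc.inftyValuation k).integer

open Classical in
theorem mem_regularAtInfty_iff {r : RatFunc k} :
    r ∈ regularAtInfty k ↔ RatFunc.inftyValuation k r ≤ 1 := Iff.rfl

theorem algebraMap_mul_inv_pow_mem_regularAtInfty {p : k[X]} {n : ℕ} (hp : p.natDegree ≤ n) :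
    algebraMap k[X] (RatFunc k) p * (RatFunc.X⁻¹) ^ n ∈ regularAtInfty k := by
  classical
  rw [mem_regularAtInfty_iff]
  rcases eq_or_ne p 0 with rfl | h0
  · simp
  · rw [map_mul, map_pow, map_inv₀, RatFunc.inftyValuation.X, RatFunc.inftyValuation_apply,
      RatFunc.inftyValuation.polynomial _ h0, ← WithZero.exp_neg, ← WithZero.exp_nsmul,
      ← WithZero.exp_add, ← WithZero.exp_zero, WithZero.exp_le_exp]
    simpa using hp

theorem natDegree_eq_zero_of_mem_regularAtInfty {p : k[X]}
    (hp : algebraMap k[X] (RatFunc k) p ∈ regularAtInfty k) : p.natDegree = 0 := by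
  classical
  rcases eq_or_ne p 0 with rfl | h0
  · simp
  · rw [mem_regularAtInfty_iff, RatFunc.inftyValuation_apply,
      RatFunc.inftyValuation.polynomial _ h0, ← WithZero.exp_zero, WithZero.exp_le_exp] at hp
    simpa using hp

theorem mem_regularAtInfty_of_isIntegral {r : RatFunc k} (hr : IsIntegral (regularAtInfty k) r) :
    r ∈ regularAtInfty k := by
  classical
  exact (Valuation.integer.integers (RatFunc.inftyValuation k)).mem_of_integral hr

variable (A K : Type*) [CommRing A] [Algebra k A] [Algebra k[X] A] [IsScalarTower k k[X] A]
  [Field K] [Algebra A K] [Algebra k[X] K] [IsScalarTower k[X] A K]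
  [Algebra (RatFunc k) K] [IsScalarTower k[X] (RatFunc k) K]

/-- The elements of `A` which, multiplied by `X⁻ᵈ`, become integral over the rational functions
regular at infinity: the functions on `A` with poles at infinity bounded by those of `Xᵈ`. -/
noncomputable def boundedPoles (d : ℕ) : Submodule k A where
  carrier := {g | IsIntegral (regularAtInfty k)
    (algebraMap A K g * algebraMap (RatFunc k) K (RatFunc.X⁻¹ ^ d))}
  zero_mem' := by simpa using isIntegral_zero
  add_mem' {a b} ha hb := by
    simpa [add_mul] using IsIntegral.add ha hb
  smul_mem' c a ha := by
    have hc : algebraMap k[X] (RatFunc k) (C c) ∈ regularAtInfty k := by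
      simpa using algebraMap_mul_inv_pow_mem_regularAtInfty k (p := C c) (n := 0) (by simp)
    have h := IsIntegral.smul (⟨_, hc⟩ : regularAtInfty k) ha
    have e : c • a = algebraMap k[X] A (C c) * a := by
      rw [Algebra.smul_def, IsScalarTower.algebraMap_apply k k[X] A]; rfl
    show IsIntegral _ _
    rw [e, map_mul, ← IsScalarTower.algebraMap_apply k[X] A K,
      IsScalarTower.algebraMap_apply k[X] (RatFunc k) K, mul_assoc, ← Algebra.smul_def]
    exact h

variable {A}
theorem mem_boundedPoles_iff {d : ℕ} {g : A} : g ∈ boundedPoles k A K d ↔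
    IsIntegral (regularAtInfty k)
      (algebraMap A K g * algebraMap (RatFunc k) K (RatFunc.X⁻¹ ^ d)) := Iff.rfl

theorem mem_boundedPoles_of_natDegree_coeff_le {d : ℕ} {g : A} {P : k[X][X]} (hP : P.Monic)
    (hg : aeval g P = 0) (hd : ∀ i, (P.coeff i).natDegree ≤ d) : g ∈ boundedPoles k A K d := by
  set s : RatFunc k := RatFunc.X⁻¹ ^ d with hs
  have hsO : s ∈ regularAtInfty k := by
    simpa [hs] using algebraMap_mul_inv_pow_mem_regularAtInfty k (p := 1) (n := d) (by simp)
  set P' : (RatFunc k)[X] := scaleRoots (P.map (algebraMap k[X] (RatFunc k))) s with hP'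
  have hmon : P'.Monic := (monic_scaleRoots_iff s).mpr (hP.map _)
  have hcoeff : (P'.coeffs : Set (RatFunc k)) ⊆ regularAtInfty k := by
    intro c hc
    obtain ⟨i, hi, rfl⟩ := mem_coeffs_iff.mp hc
    rw [hP', coeff_scaleRoots, coeff_map]
    rcases Nat.eq_zero_or_pos ((P.map (algebraMap k[X] (RatFunc k))).natDegree - i) with h0 | hpos
    · have hle : P'.natDegree ≤ i := by
        rw [hP', natDegree_scaleRoots]; omega
      have hi' : i = P.natDegree := by
        rw [← hP.natDegree_map (algebraMap k[X] (RatFunc k)),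
          ← natDegree_scaleRoots (P.map (algebraMap k[X] (RatFunc k))) s]
        exact le_antisymm (le_natDegree_of_mem_supp _ hi) hle
      rw [h0, hi', coeff_natDegree, hP.leadingCoeff]
      simp
    · obtain ⟨m, hm⟩ := Nat.exists_eq_succ_of_ne_zero hpos.ne'
      rw [hm, pow_succ', ← mul_assoc]
      exact mul_mem (algebraMap_mul_inv_pow_mem_regularAtInfty k (hd i)) (pow_mem hsO m)
  refine ⟨P'.toSubring _ hcoeff, (monic_toSubring _ _ hcoeff).mpr hmon, ?_⟩
  have h1 : aeval (algebraMap A K g) (P.map (algebraMap k[X] (RatFunc k))) = 0 := by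
    rw [aeval_map_algebraMap, aeval_algebraMap_apply, hg, map_zero]
  have h2 := scaleRoots_aeval_eq_zero (r := s) h1
  rw [mul_comm]
  rw [← hP', ← map_toSubring P' _ hcoeff, aeval_def, eval₂_map] at h2
  exact h2

theorem mem_boundedPoles_of_aevalAeval_eq_zero [IsDomain A] [FaithfulSMul k[X] A]
    [Algebra.IsIntegral k[X] A] {d : ℕ} {g : A} {Q : k[X][X]} (hQ : Q ≠ 0) (hd : Q.natDegree ≤ d)
    (hg : aevalAeval g (algebraMap k[X] A X) Q = 0) : g ∈ boundedPoles k A K d := by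
  have hint : IsIntegral k[X] g := Algebra.IsIntegral.isIntegral g
  have hdvd : minpoly k[X] g ∣ Bivariate.swap Q := by
    refine minpoly.isIntegrallyClosed_dvd hint ?_
    rw [← aevalAeval_algebraMap_X, Bivariate.aevalAeval_swap, hg]
  have hdvd' : Bivariate.swap (minpoly k[X] g) ∣ Q := by
    have := map_dvd (Bivariate.swap (R := k)) hdvd
    rwa [Bivariate.swap_swap_apply] at this
  refine mem_boundedPoles_of_natDegree_coeff_le k K (minpoly.monic hint) (minpoly.aeval _ _)
    fun i ↦ natDegree_le_iff_coeff_eq_zero.mpr fun j hj ↦ ?_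
  rw [← Bivariate.coeff_coeff_swap_s1, coeff_eq_zero_of_natDegree_lt (p := Bivariate.swap _) ?_,
    coeff_zero]
  exact ((natDegree_le_of_dvd hdvd' hQ).trans hd).trans_lt hj

variable [FaithfulSMul A K] [FiniteDimensional (RatFunc k) K]

theorem eq_zero_of_X_pow_smul_mem_boundedPoles [Algebra.IsIntegral k[X] A] {d : ℕ} {h : A}
    (hh : (X ^ (d + 1) : k[X]) • h ∈ boundedPoles k A K d) : h = 0 := by
  have hinj := FaithfulSMul.algebraMap_injective A K
  have h1 : IsIntegral k[X] (Algebra.norm (RatFunc k) (algebraMap A K h)) :=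
    Algebra.isIntegral_norm _ ((Algebra.IsIntegral.isIntegral (R := k[X]) h).algebraMap)
  obtain ⟨p, hp⟩ := IsIntegrallyClosed.isIntegral_iff.mp h1
  have e : algebraMap A K ((X ^ (d + 1) : k[X]) • h) * algebraMap (RatFunc k) K (RatFunc.X⁻¹ ^ d)
      = algebraMap (RatFunc k) K RatFunc.X * algebraMap A K h := by
    have hX : (RatFunc.X : RatFunc k) ≠ 0 := RatFunc.X_ne_zero
    rw [Algebra.smul_def, map_mul, ← IsScalarTower.algebraMap_apply k[X] A K,
      IsScalarTower.algebraMap_apply k[X] (RatFunc k) K, mul_right_comm, ← map_mul, map_pow,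
      RatFunc.algebraMap_X]
    congr 2
    rw [pow_succ', mul_assoc, ← mul_pow, mul_inv_cancel₀ hX, one_pow, mul_one]
  rw [mem_boundedPoles_iff, e] at hh
  have h2 := mem_regularAtInfty_of_isIntegral k (Algebra.isIntegral_norm (RatFunc k) hh)
  rw [map_mul, Algebra.norm_algebraMap, ← hp, ← RatFunc.algebraMap_X, ← map_pow, ← map_mul] at h2
  have h3 := natDegree_eq_zero_of_mem_regularAtInfty k h2
  have hn : 0 < Module.finrank (RatFunc k) K := Module.finrank_pos
  have hp0 : p = 0 := by
    by_contra hp0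
    rw [natDegree_mul (by simp) hp0, natDegree_X_pow] at h3
    omega
  rw [hp0, map_zero] at hp
  exact hinj (by simpa using (Algebra.norm_eq_zero_iff.mp hp.symm))

theorem finiteDimensional_boundedPoles [Module.Finite k[X] A] (d : ℕ) :
    FiniteDimensional k (boundedPoles k A K d) := by
  obtain ⟨n, b, hb⟩ := Module.Finite.exists_fin (R := k[X]) (M := A)
  let N : Submodule k A := Submodule.span k
    (Set.range fun ij : Fin n × Fin (d + 1) ↦ (X ^ (ij.2 : ℕ) : k[X]) • b ij.1)
  let I : Submodule k A :=
    (LinearMap.range (LinearMap.lsmul k[X] A (X ^ (d + 1)))).restrictScalars k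
  have hsmul (p : k[X]) (i : Fin n) : p • b i ∈ N ⊔ I := by
    have hm : (X ^ (d + 1) : k[X]).Monic := monic_X_pow _
    rw [← modByMonic_add_div p (X ^ (d + 1)), add_smul, mul_smul]
    refine add_mem (Submodule.mem_sup_left ?_) (Submodule.mem_sup_right ⟨_, rfl⟩)
    have hdeg : (p %ₘ X ^ (d + 1)).natDegree < d + 1 := by
      simpa using natDegree_modByMonic_lt p hm fun h ↦ by simpa using congrArg natDegree h
    rw [as_sum_range' _ _ hdeg, Finset.sum_smul]
    refine sum_mem fun j hj ↦ ?_
    rw [← C_mul_X_pow_eq_monomial, ← smul_eq_C_mul, smul_assoc]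
    exact N.smul_mem _ (Submodule.subset_span ⟨(i, ⟨j, Finset.mem_range.mp hj⟩), rfl⟩)
  have hNI : N ⊔ I = ⊤ := by
    refine eq_top_iff.mpr fun a _ ↦ ?_
    obtain ⟨c, rfl⟩ := (Submodule.mem_span_range_iff_exists_fun k[X]).mp
      (hb ▸ Submodule.mem_top : a ∈ Submodule.span k[X] (Set.range b))
    exact sum_mem fun i _ ↦ hsmul _ _
  have hN : FiniteDimensional k N := FiniteDimensional.span_of_finite k (Set.finite_range _)
  have hquot : FiniteDimensional k (A ⧸ I) := by
    refine Module.Finite.of_surjective (I.mkQ ∘ₗ N.subtype) ?_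
    rw [← LinearMap.range_eq_top, LinearMap.range_comp, Submodule.range_subtype,
      Submodule.map_mkQ_eq_top, sup_comm, hNI]
  refine FiniteDimensional.of_injective (I.mkQ ∘ₗ (boundedPoles k A K d).subtype)
    ((injective_iff_map_eq_zero _).mpr ?_)
  rintro ⟨g, hg⟩ h0
  obtain ⟨h, rfl⟩ := (Submodule.Quotient.mk_eq_zero I).mp h0
  have := eq_zero_of_X_pow_smul_mem_boundedPoles k K hg
  simp [this]

end Pole

theorem exists_natDegree_le_of_isAlgebraic (B A : Type*) [CommRing B] [IsDomain B] [CommRing A]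
    [IsDomain A] [Algebra B A] [FaithfulSMul B A] [Algebra.FiniteType B A]
    [Algebra.IsAlgebraic B A] :
    ∃ d : ℕ, ∀ y : A, ∃ Q : B[X], Q ≠ 0 ∧ Q.natDegree ≤ d ∧ aeval y Q = 0 := by
  let F := FractionRing B
  let K := FractionRing A
  let : Algebra F K := FractionRing.liftAlgebra B K
  have hinj : Function.Injective (algebraMap A K) := IsFractionRing.injective A K
  obtain ⟨s, hs⟩ := Algebra.FiniteType.out (R := B) (A := A)
  let t : Set K := algebraMap A K '' s
  let L := IntermediateField.adjoin F t
  have hfin : FiniteDimensional F L := by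
    have : Finite t := (s.finite_toSet.image _).to_subtype
    refine IntermediateField.finiteDimensional_adjoin fun x hx ↦ ?_
    obtain ⟨a, -, rfl⟩ := hx
    have ha : IsAlgebraic B (algebraMap A K a) :=
      (Algebra.IsAlgebraic.isAlgebraic (R := B) a).algebraMap
    exact (ha.extendScalars (IsFractionRing.injective B F)).isIntegral
  have hL (y : A) : algebraMap A K y ∈ L := by
    have hy : y ∈ Algebra.adjoin B (s : Set A) := hs ▸ Algebra.mem_top
    induction hy using Algebra.adjoin_induction with
    | mem x hx => exact IntermediateField.subset_adjoin _ _ ⟨x, hx, rfl⟩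
    | algebraMap r =>
      rw [← IsScalarTower.algebraMap_apply B A K, IsScalarTower.algebraMap_apply B F K]
      exact L.algebraMap_mem _
    | add x y _ _ hx hy => rw [map_add]; exact add_mem hx hy
    | mul x y _ _ hx hy => rw [map_mul]; exact mul_mem hx hy
  refine ⟨Module.finrank F L, fun y ↦ ?_⟩
  let z : L := ⟨_, hL y⟩
  obtain ⟨b, hb, hbQ⟩ := IsLocalization.integerNormalization_spec (nonZeroDivisors B) (minpoly F z)
  have hb0 : algebraMap B F b ≠ 0 := by
    simpa using nonZeroDivisors.ne_zero hb
  set Q := IsLocalization.integerNormalization (nonZeroDivisors B) (minpoly F z)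
  have hbQ' : Q.map (algebraMap B F) = C (algebraMap B F b) * minpoly F z := by
    rw [hbQ, ← smul_eq_C_mul]
    ext i
    simp [Algebra.smul_def]
  have hz : IsIntegral F z := Algebra.IsIntegral.isIntegral z
  have hFinj : Function.Injective (algebraMap B F) := IsFractionRing.injective B F
  refine ⟨Q, fun h0 ↦ ?_, ?_, hinj ?_⟩
  · rw [h0, Polynomial.map_zero] at hbQ'
    exact mul_ne_zero (C_ne_zero.mpr hb0) (minpoly.ne_zero hz) hbQ'.symm
  · rw [← natDegree_map_eq_of_injective hFinj, hbQ', natDegree_C_mul hb0]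
    exact minpoly.natDegree_le z
  · rw [map_zero, ← aeval_algebraMap_apply, ← aeval_map_algebraMap F, hbQ', map_mul]
    have : aeval (algebraMap A K y) (minpoly F z) = algebraMap L K (aeval z (minpoly F z)) := by
      rw [← aeval_algebraMap_apply]; rfl
    rw [this, minpoly.aeval, map_zero, mul_zero]

theorem ringKrullDim_le_of_isIntegral (A B : Type*) [CommRing A] [CommRing B] [Algebra A B]
    [Algebra.IsIntegral A B] [FaithfulSMul A B] : ringKrullDim A ≤ ringKrullDim B := by
  refine iSup_le fun l ↦ ?_
  obtain ⟨P, hP, hl⟩ := (Ideal.nonempty_primesOver (S := B) (RelSeries.head l).asIdeal).some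
  obtain ⟨L, hL, -⟩ := Ideal.exists_ltSeries_of_hasGoingUp l P
  rw [← hL]
  exact Order.LTSeries.length_le_krullDim L

theorem exists_finite_injective_polynomial_algHom {k A : Type*} [Field k] [CommRing A] [IsDomain A]
    [Algebra k A] [Algebra.FiniteType k A] (hdim : ringKrullDim A ≤ 1)
    (hA : Algebra.Transcendental k A) :
    ∃ g : k[X] →ₐ[k] A, Function.Injective g ∧ g.Finite := by
  obtain ⟨s, g, hg, hgf⟩ := exists_finite_inj_algHom_of_fg k A
  have hs1 : s ≤ 1 := by
    algebraize [g.toRingHom]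
    have : Module.Finite (MvPolynomial (Fin s) k) A := hgf
    have : FaithfulSMul (MvPolynomial (Fin s) k) A :=
      (faithfulSMul_iff_algebraMap_injective _ _).mpr hg
    have h := (ringKrullDim_le_of_isIntegral (MvPolynomial (Fin s) k) A).trans hdim
    rw [MvPolynomial.ringKrullDim_of_isNoetherianRing, ringKrullDim_eq_zero_of_field] at h
    simpa using h
  interval_cases s
  · have : Module.Finite k A := by
      have h : (g.comp (MvPolynomial.isEmptyAlgEquiv k (Fin 0)).symm.toAlgHom).Finite :=
        hgf.comp (.of_surjective _ (AlgEquiv.surjective _))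
      rw [Subsingleton.elim (AlgHom.comp _ _) (Algebra.ofId k A)] at h
      exact RingHom.finite_algebraMap.mp h
    exact absurd (inferInstance : Algebra.IsAlgebraic k A)
      (Algebra.transcendental_iff_not_isAlgebraic.mp hA)
  · let e : k[X] ≃ₐ[k] MvPolynomial (Fin 1) k := (MvPolynomial.uniqueAlgEquiv k (Fin 1)).symm
    exact ⟨g.comp e.toAlgHom, hg.comp e.injective, hgf.comp (.of_surjective _ e.surjective)⟩

theorem trdeg_eq_one_iff_isAlgebraic_polynomial {k A : Type*} [Field k] [CommRing A] [IsDomain A]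
    [Algebra k A] [Algebra k[X] A] [IsScalarTower k k[X] A] [FaithfulSMul k[X] A] :
    Algebra.trdeg k A = 1 ↔ Algebra.IsAlgebraic k[X] A := by
  have h := lift_trdeg_add_eq k k[X] A
  rw [Polynomial.trdeg_of_isDomain, Cardinal.lift_one] at h
  rw [← trdeg_eq_zero_iff, ← Cardinal.lift_eq_one, ← h, ← Cardinal.lift_eq_zero]
  refine ⟨fun h ↦ ?_, fun h ↦ by rw [h, add_zero]⟩
  exact Cardinal.eq_of_add_eq_add_left (h.trans (add_zero 1).symm) Cardinal.one_lt_aleph0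

theorem exists_natDegree_le_aevalAeval_eq_zero {k A : Type*} [Field k] [CommRing A] [IsDomain A]
    [Algebra k A] [Algebra.FiniteType k A] (htr : Algebra.trdeg k A = 1) {f : A}
    (hf : Transcendental k f) :
    ∃ d : ℕ, ∀ y : A, ∃ Q : k[X][X], Q ≠ 0 ∧ Q.natDegree ≤ d ∧ aevalAeval f y Q = 0 := by
  let : Algebra k[X] A := (aeval (R := k) f).toRingHom.toAlgebra
  have : IsScalarTower k k[X] A := .of_algebraMap_eq fun x ↦ ((aeval f).commutes x).symm
  have : FaithfulSMul k[X] A := (faithfulSMul_iff_algebraMap_injective _ _).mpr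
    (transcendental_iff_injective.mp hf)
  have : Algebra.IsAlgebraic k[X] A := trdeg_eq_one_iff_isAlgebraic_polynomial.mp htr
  have : Algebra.FiniteType k[X] A := .of_restrictScalars_finiteType k k[X] A
  obtain ⟨d, hd⟩ := exists_natDegree_le_of_isAlgebraic k[X] A
  refine ⟨d, fun y ↦ ?_⟩
  obtain ⟨Q, hQ, hQd, hQy⟩ := hd y
  have hX : algebraMap k[X] A X = f := aeval_X (R := k) f
  exact ⟨Q, hQ, hQd, by rw [← hX, aevalAeval_algebraMap_X, hQy]⟩

theorem Polynomial.aevalAeval_algHom_apply {k A B : Type*} [CommSemiring k] [CommSemiring A]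
    [CommSemiring B] [Algebra k A] [Algebra k B] (φ : A →ₐ[k] B) (x y : A) (p : k[X][X]) :
    aevalAeval (φ x) (φ y) p = φ (aevalAeval x y p) := by
  induction p using Polynomial.induction_on' with
  | add p q hp hq => simp only [map_add, hp, hq]
  | monomial n a =>
    rw [← C_mul_X_pow_eq_monomial]
    simp only [map_mul, map_pow, aevalAeval_C, aevalAeval_Y, aeval_algHom_apply]

theorem AlgEquiv.finiteDimensional_span_orbit_of_isDomain {k A : Type*} [Field k] [CommRing A]
    [IsDomain A] [Algebra k A] [Algebra.FiniteType k A] (hdim : ringKrullDim A ≤ 1)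
    (τ : A ≃ₐ[k] A) (f : A) :
    FiniteDimensional k (Submodule.span k (Set.range fun n : ℕ ↦ (τ ^ n) f)) := by
  by_cases hf : Transcendental k f
  · obtain ⟨g, hg, hgfin⟩ :=
      exists_finite_injective_polynomial_algHom hdim ⟨f, hf⟩
    let : Algebra k[X] A := g.toRingHom.toAlgebra
    have : IsScalarTower k k[X] A := .of_algebraMap_eq fun x ↦ (g.commutes x).symm
    have : FaithfulSMul k[X] A := (faithfulSMul_iff_algebraMap_injective _ _).mpr hg
    have : Module.Finite k[X] A := hgfin
    have htr : Algebra.trdeg k A = 1 :=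
      trdeg_eq_one_iff_isAlgebraic_polynomial.mpr inferInstance
    let K := FractionRing A
    let : Algebra (RatFunc k) K := RatFunc.liftAlgebra k K
    have : IsScalarTower k[X] (RatFunc k) K := RatFunc.isScalarTower_liftAlgebra k K
    have : FiniteDimensional (RatFunc k) K :=
      Module.Finite.of_isLocalization k[X] A (nonZeroDivisors k[X])
    obtain ⟨d, hd⟩ := exists_natDegree_le_aevalAeval_eq_zero htr hf
    have hfin := finiteDimensional_boundedPoles (A := A) k K d
    refine Submodule.finiteDimensional_of_le (Submodule.span_le.mpr ?_ :
      _ ≤ boundedPoles k A K d)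
    rintro _ ⟨n, rfl⟩
    obtain ⟨Q, hQ, hQd, hQy⟩ := hd ((τ ^ n).symm (algebraMap k[X] A X))
    refine mem_boundedPoles_of_aevalAeval_eq_zero k K hQ hQd ?_
    have h := aevalAeval_algHom_apply (τ ^ n).toAlgHom f ((τ ^ n).symm (algebraMap k[X] A X)) Q
    rw [hQy, map_zero] at h
    simpa using h
  · obtain ⟨p, hp, hpf⟩ := not_not.mp hf
    refine FiniteDimensional.span_of_finite k ((p.rootSet_finite A).subset ?_)
    rintro _ ⟨n, rfl⟩
    refine (mem_rootSet.mpr ⟨hp, ?_⟩)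
    rw [aeval_algHom_apply, hpf, map_zero]

theorem exists_pow_comap_eq_of_mem_minimalPrimes {k R : Type*} [CommSemiring k] [CommRing R]
    [Algebra k R] [IsNoetherianRing R] (σ : R ≃ₐ[k] R) :
    ∃ m : ℕ, 0 < m ∧ ∀ p ∈ minimalPrimes R, p.comap ((σ ^ m : R ≃ₐ[k] R) : R →+* R) = p := by
  have hcomap (m : ℕ) (p : Ideal R) :
      (Ideal.comap (σ : R →+* R))^[m] p = p.comap ((σ ^ m : R ≃ₐ[k] R) : R →+* R) := by
    induction m with
    | zero => rfl
    | succ m ih => rw [Function.iterate_succ_apply', ih, Ideal.comap_comap]; congr 1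
  have himage := Ideal.comap_minimalPrimes_eq_of_surjective (f := (σ : R →+* R)) σ.surjective ⊥
  have hbot : (⊥ : Ideal R).comap (σ : R →+* R) = ⊥ :=
    (RingHom.injective_iff_ker_eq_bot _).mp σ.injective
  rw [hbot] at himage
  have hmaps : Set.MapsTo (Ideal.comap (σ : R →+* R)) (minimalPrimes R) (minimalPrimes R) :=
    fun p hp ↦ himage.ge (Set.mem_image_of_mem _ hp)
  have hinj : Function.Injective (Ideal.comap (σ : R →+* R)) :=
    Ideal.comap_injective_of_surjective _ σ.surjective
  have : Finite (minimalPrimes R) := (minimalPrimes.finite_of_isNoetherianRing R).to_subtype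
  let e : Equiv.Perm (minimalPrimes R) :=
    .ofBijective _ (Finite.injective_iff_bijective.mp (hmaps.restrict_inj.mpr hinj.injOn))
  refine ⟨orderOf e, orderOf_pos e, fun p hp ↦ ?_⟩
  have h := congrArg Subtype.val (DFunLike.congr_fun (pow_orderOf_eq_one e) ⟨p, hp⟩)
  rw [← Equiv.Perm.iterate_eq_pow] at h
  rw [← hcomap]
  exact (hmaps.coe_iterate_restrict ⟨p, hp⟩ (orderOf e)).symm.trans h

theorem finiteDimensional_of_forall_mem_of_forall_eq_zero {k M ι : Type*} {N : ι → Type*} [Field k]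
    [AddCommGroup M] [Module k M] [∀ i, AddCommGroup (N i)] [∀ i, Module k (N i)] [Finite ι]
    {W : Submodule k M} (S : ∀ i, Submodule k (N i)) [∀ i, FiniteDimensional k (S i)]
    (φ : ∀ i, M →ₗ[k] N i) (hφ : ∀ i, ∀ x ∈ W, φ i x ∈ S i)
    (h0 : ∀ x, (∀ i, φ i x = 0) → x = 0) : FiniteDimensional k W := by
  refine FiniteDimensional.of_injective (LinearMap.pi fun i ↦ (φ i).restrict (hφ i))
    ((injective_iff_map_eq_zero _).mpr fun x hx ↦ Subtype.ext (h0 x fun i ↦ ?_))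
  exact congrArg Subtype.val (congrFun hx i)

theorem AlgEquiv.exists_quotient_algEquiv {k R : Type*} [CommSemiring k] [CommRing R]
    [Algebra k R] (τ : R ≃ₐ[k] R) {p : Ideal R} (hp : p.comap (τ : R →+* R) = p) :
    ∃ τ' : (R ⧸ p) ≃ₐ[k] R ⧸ p, ∀ (n : ℕ) (x : R),
      (τ' ^ n) (Ideal.Quotient.mk p x) = Ideal.Quotient.mk p ((τ ^ n) x) := by
  have hmap : p = p.map (τ : R →+* R) := by
    conv_rhs => rw [← hp]
    exact (Ideal.map_comap_of_surjective (τ : R →+* R) τ.surjective _).symm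
  refine ⟨Ideal.quotientEquivAlg p p τ hmap, fun n x ↦ ?_⟩
  induction n with
  | zero => rfl
  | succ n ih => rw [pow_succ', pow_succ', AlgEquiv.mul_apply, ih]; rfl

theorem AlgEquiv.finiteDimensional_span_orbit_of_comap_eq {k R : Type*} [Field k] [CommRing R]
    [IsReduced R] [Algebra k R] [Algebra.FiniteType k R] (hdim : ringKrullDim R ≤ 1)
    (τ : R ≃ₐ[k] R) (hτ : ∀ p ∈ minimalPrimes R, p.comap (τ : R →+* R) = p) (f : R) :
    FiniteDimensional k (Submodule.span k (Set.range fun n : ℕ ↦ (τ ^ n) f)) := by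
  have : IsNoetherianRing R := Algebra.FiniteType.isNoetherianRing k R
  have : Finite (minimalPrimes R) := (minimalPrimes.finite_of_isNoetherianRing R).to_subtype
  choose τ' hτ' using fun p : minimalPrimes R ↦ τ.exists_quotient_algEquiv (hτ p p.2)
  let S (p : minimalPrimes R) : Submodule k (R ⧸ p.1) :=
    Submodule.span k (Set.range fun n : ℕ ↦ (τ' p ^ n) (Ideal.Quotient.mk p.1 f))
  have hS (p : minimalPrimes R) : FiniteDimensional k (S p) := by
    have : p.1.IsPrime := p.2.1.1
    exact finiteDimensional_span_orbit_of_isDomain ((ringKrullDim_quotient_le _).trans hdim) _ _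
  have hmem (p : minimalPrimes R) (x : R)
      (hx : x ∈ Submodule.span k (Set.range fun n : ℕ ↦ (τ ^ n) f)) :
      (Ideal.Quotient.mkₐ k p.1).toLinearMap x ∈ S p := by
    refine Submodule.span_le (p := (S p).comap (Ideal.Quotient.mkₐ k p.1).toLinearMap) |>.mpr ?_ hx
    rintro _ ⟨n, rfl⟩
    exact Submodule.subset_span ⟨n, hτ' p n f⟩
  refine finiteDimensional_of_forall_mem_of_forall_eq_zero S
    (fun p ↦ (Ideal.Quotient.mkₐ k p.1).toLinearMap) hmem fun x hx ↦ ?_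
  have hx0 : x ∈ sInf (minimalPrimes R) :=
    Submodule.mem_sInf.mpr fun p hp ↦ Ideal.Quotient.eq_zero_iff_mem.mp (hx ⟨p, hp⟩)
  have hrad : sInf (minimalPrimes R) = ⊥ := by
    rw [minimalPrimes, Ideal.sInf_minimalPrimes]
    exact nilradical_eq_zero R
  rw [hrad] at hx0
  simpa using hx0

theorem AlgEquiv.finiteDimensional_span_orbit {k R : Type*} [Field k] [CommRing R]
    [IsReduced R] [Algebra k R] [Algebra.FiniteType k R] (hdim : ringKrullDim R ≤ 1)
    (σ : R ≃ₐ[k] R) (f : R) :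
    FiniteDimensional k (Submodule.span k (Set.range fun n : ℕ ↦ (σ ^ n) f)) := by
  have : IsNoetherianRing R := Algebra.FiniteType.isNoetherianRing k R
  obtain ⟨m, hm, hσ⟩ := exists_pow_comap_eq_of_mem_minimalPrimes σ
  let T (j : Fin m) : Submodule k R :=
    Submodule.span k (Set.range fun n : ℕ ↦ ((σ ^ m) ^ n) ((σ ^ (j : ℕ)) f))
  have hT (j : Fin m) : FiniteDimensional k (T j) :=
    finiteDimensional_span_orbit_of_comap_eq hdim _ hσ _
  refine Submodule.finiteDimensional_of_le (Submodule.span_le.mpr ?_ : _ ≤ ⨆ j, T j)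
  rintro _ ⟨n, rfl⟩
  refine Submodule.mem_iSup_of_mem ⟨n % m, Nat.mod_lt n hm⟩ (Submodule.subset_span ⟨n / m, ?_⟩)
  simp only [← AlgEquiv.mul_apply, ← pow_mul, ← pow_add, Nat.div_add_mod]

end

/-- Let `k` be an algebraically closed field and let `R` be a finitely generated reduced
commutative `k`-algebra of Krull dimension at most one.  Then every `k`-algebra
automorphism `σ` of `R` preserves a frame. -/
theorem automorphism_preserves_frame_of_reduced_dim_le_one
    (k R : Type*) [Field k] [IsAlgClosed k] [CommRing R] [IsReduced R]
    [Algebra k R] [Algebra.FiniteType k R]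
    (hdim : ringKrullDim R ≤ 1)
    (σ : R ≃ₐ[k] R) :
    ∃ V : Submodule k R, IsFrame k V ∧ V.map σ.toLinearMap = V := by
  obtain ⟨s, hs⟩ := Algebra.FiniteType.out (R := k) (A := R)
  let T (f : R) : Submodule k R := Submodule.span k (Set.range fun n : ℕ ↦ (σ ^ n) f)
  have hT (f : R) : FiniteDimensional k (T f) := σ.finiteDimensional_span_orbit hdim f
  have hself (f : R) : f ∈ T f := Submodule.subset_span ⟨0, rfl⟩
  have hTσ (f : R) : (T f).map σ.toLinearMap ≤ T f := by
    rw [Submodule.map_span, Submodule.span_le]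
    rintro _ ⟨_, ⟨n, rfl⟩, rfl⟩
    exact Submodule.subset_span ⟨n + 1, by simp only [pow_succ']; rfl⟩
  let V : Submodule k R := T 1 ⊔ ⨆ f : s, T f
  have hV : FiniteDimensional k V := inferInstance
  have hle : V.map σ.toLinearMap ≤ V := by
    rw [Submodule.map_sup, Submodule.map_iSup]
    exact sup_le_sup (hTσ 1) (iSup_mono fun f ↦ hTσ f)
  refine ⟨V, ⟨Submodule.mem_sup_left (hself 1), hV, ?_⟩,
    Submodule.eq_of_le_of_finrank_eq hle (LinearEquiv.finrank_map_eq σ.toLinearEquiv V)⟩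
  rw [eq_top_iff, ← hs]
  exact Algebra.adjoin_mono fun f hf ↦
    Submodule.mem_sup_right (Submodule.mem_iSup_of_mem ⟨f, hf⟩ (hself f))
end
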